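/- arXiv:2412.15977 — 2 statements merged into one kernel-verified Lean document; each statement's English description precedes it below -/
import Mathlib

section
/- Suppose Δy ≠ 0 and let Δȳ = Δy/‖Δy‖₂ + E^Q for some error vector E^Q ∈ ℝ^m. If ‖E^Q‖₂ ≤ (0.005/1.995)·(1/√κ(AS⁻²Aᵀ)), then the angle ψ between the vectors S⁻¹AᵀΔy and S⁻¹AᵀΔȳ satisfies sin ψ ≤ 0.1 (equivalently, cos ψ ≥ 0.995, where cos ψ = ⟨S⁻¹AᵀΔy, S⁻¹AᵀΔȳ⟩/(‖S⁻¹AᵀΔy‖₂·‖S⁻¹AᵀΔȳ‖₂)). -/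
open Matrix

/-- Euclidean norm of a vector in `ℝ^k`. -/
noncomputable def norm2 {k : ℕ} (v : Fin k → ℝ) : ℝ := Real.sqrt (∑ i, v i ^ 2)

theorem norm2_eq_norm {k : ℕ} (v : Fin k → ℝ) : norm2 v = ‖WithLp.toLp 2 v‖ := by
  simp [norm2, EuclideanSpace.norm_eq]

theorem norm2_nonneg {k : ℕ} (v : Fin k → ℝ) : 0 ≤ norm2 v := Real.sqrt_nonneg _

theorem norm2_sq {k : ℕ} (v : Fin k → ℝ) : norm2 v ^ 2 = v ⬝ᵥ v := by
  rw [norm2, Real.sq_sqrt (Finset.sum_nonneg fun i _ => sq_nonneg (v i))]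
  simp [dotProduct, sq]

theorem norm2_pos {k : ℕ} {v : Fin k → ℝ} (hv : v ≠ 0) : 0 < norm2 v := by
  simpa [norm2_eq_norm] using hv

theorem abs_dotProduct_le_norm2_mul_norm2 {k : ℕ} (u v : Fin k → ℝ) :
    |u ⬝ᵥ v| ≤ norm2 u * norm2 v := by
  have h := abs_real_inner_le_norm (WithLp.toLp 2 v) (WithLp.toLp 2 u)
  rw [EuclideanSpace.inner_toLp_toLp, star_trivial] at h
  rwa [norm2_eq_norm, norm2_eq_norm, mul_comm]

theorem norm2_smul_add_le {k : ℕ} {t : ℝ} (ht : 0 ≤ t) (u v : Fin k → ℝ) :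
    norm2 (t • u + v) ≤ t * norm2 u + norm2 v := by
  simp only [norm2_eq_norm, WithLp.toLp_add, WithLp.toLp_smul]
  refine (norm_add_le _ _).trans_eq ?_
  rw [norm_smul, Real.norm_of_nonneg ht]

/-- A perturbation of relative size `ε` keeps the cosine of the angle above `(1 - ε) / (1 + ε)`. -/
theorem le_cos_angle_of_relative_perturbation {k : ℕ} {u v : Fin k → ℝ} {t ε : ℝ} (ht : 0 < t)
    (hε₀ : 0 ≤ ε) (hε₁ : ε < 1) (hu : 0 < norm2 u) (hv : norm2 v ≤ ε * (t * norm2 u)) :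
    (1 - ε) / (1 + ε) ≤ (u ⬝ᵥ (t • u + v)) / (norm2 u * norm2 (t • u + v)) := by
  have hdot : (1 - ε) * (t * norm2 u) * norm2 u ≤ u ⬝ᵥ (t • u + v) := by
    have h := (abs_le.1 (abs_dotProduct_le_norm2_mul_norm2 u v)).1
    rw [dotProduct_add, dotProduct_smul, ← norm2_sq, smul_eq_mul]
    nlinarith [mul_le_mul_of_nonneg_left hv hu.le]
  have hdot_pos : 0 < u ⬝ᵥ (t • u + v) :=
    (mul_pos (mul_pos (sub_pos.2 hε₁) (mul_pos ht hu)) hu).trans_le hdot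
  have hprod : 0 < norm2 u * norm2 (t • u + v) :=
    (hdot_pos.trans_le (le_abs_self _)).trans_le (abs_dotProduct_le_norm2_mul_norm2 _ _)
  have hnorm : norm2 (t • u + v) ≤ (1 + ε) * (t * norm2 u) := by
    linarith [norm2_smul_add_le ht.le u v]
  rw [div_le_div_iff₀ (by linarith) hprod]
  calc (1 - ε) * (norm2 u * norm2 (t • u + v))
      ≤ (1 - ε) * (norm2 u * ((1 + ε) * (t * norm2 u))) :=
        mul_le_mul_of_nonneg_left (mul_le_mul_of_nonneg_left hnorm hu.le) (sub_nonneg.2 hε₁.le)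
    _ = (1 - ε) * (t * norm2 u) * norm2 u * (1 + ε) := by ring
    _ ≤ _ := mul_le_mul_of_nonneg_right hdot (by linarith)

/-- Coordinates in an orthonormal eigenbasis diagonalize the quadratic form of a real symmetric
matrix and preserve the norm. -/
theorem exists_eigen_coordinates {k : ℕ} {M : Matrix (Fin k) (Fin k) ℝ} (hM : M.IsHermitian)
    (x : Fin k → ℝ) :
    ∃ y : Fin k → ℝ, norm2 x ^ 2 = ∑ i, y i ^ 2 ∧
      x ⬝ᵥ M *ᵥ x = ∑ i, hM.eigenvalues i * y i ^ 2 := by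
  let U : Matrix (Fin k) (Fin k) ℝ := (hM.eigenvectorUnitary).1
  have hUU : U * Uᵀ = 1 := Unitary.coe_mul_star_self hM.eigenvectorUnitary
  have hspec : M = U * diagonal hM.eigenvalues * Uᵀ := by
    have h := hM.spectral_theorem
    rw [Unitary.conjStarAlgAut_apply] at h
    exact h
  refine ⟨Uᵀ *ᵥ x, ?_, ?_⟩
  · have : (Uᵀ *ᵥ x) ⬝ᵥ (Uᵀ *ᵥ x) = x ⬝ᵥ x := by
      rw [dotProduct_mulVec, vecMul_transpose, mulVec_mulVec, hUU, one_mulVec]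
    rw [norm2_sq, ← this]
    simp [dotProduct, sq]
  · have : x ⬝ᵥ M *ᵥ x = (Uᵀ *ᵥ x) ⬝ᵥ (diagonal hM.eigenvalues *ᵥ (Uᵀ *ᵥ x)) := by
      conv_lhs => rw [hspec]
      rw [← mulVec_mulVec, ← mulVec_mulVec, dotProduct_mulVec, ← mulVec_transpose]
    rw [this]
    simp only [dotProduct, mulVec_diagonal]
    exact Finset.sum_congr rfl fun i _ => by ring

theorem iInf_eigenvalues_mul_le_dotProduct_mulVec {k : ℕ} {M : Matrix (Fin k) (Fin k) ℝ}
    (hM : M.IsHermitian) (x : Fin k → ℝ) :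
    (⨅ i, hM.eigenvalues i) * norm2 x ^ 2 ≤ x ⬝ᵥ M *ᵥ x := by
  obtain ⟨y, hy, hq⟩ := exists_eigen_coordinates hM x
  rw [hy, hq, Finset.mul_sum]
  exact Finset.sum_le_sum fun i _ => mul_le_mul_of_nonneg_right
    (ciInf_le (Set.finite_range _).bddBelow i) (sq_nonneg _)

theorem dotProduct_mulVec_le_iSup_eigenvalues_mul {k : ℕ} {M : Matrix (Fin k) (Fin k) ℝ}
    (hM : M.IsHermitian) (x : Fin k → ℝ) :
    x ⬝ᵥ M *ᵥ x ≤ (⨆ i, hM.eigenvalues i) * norm2 x ^ 2 := by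
  obtain ⟨y, hy, hq⟩ := exists_eigen_coordinates hM x
  rw [hy, hq, Finset.mul_sum]
  exact Finset.sum_le_sum fun i _ => mul_le_mul_of_nonneg_right
    (le_ciSup (Set.finite_range _).bddAbove i) (sq_nonneg _)

theorem norm2_scaled_transpose_mulVec_sq {m n : ℕ} (A : Matrix (Fin m) (Fin n) ℝ) (s : Fin n → ℝ)
    (x : Fin m → ℝ) :
    norm2 (s⁻¹ * Aᵀ *ᵥ x) ^ 2 = x ⬝ᵥ (A * diagonal (fun i => (s i ^ 2)⁻¹) * Aᵀ) *ᵥ x := by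
  rw [norm2_sq, ← mulVec_mulVec, ← mulVec_mulVec, dotProduct_mulVec x, ← mulVec_transpose]
  simp only [dotProduct, mulVec_diagonal, Pi.mul_apply, Pi.inv_apply]
  exact Finset.sum_congr rfl fun i _ => by rw [← inv_pow]; ring

/-- If `Δy ≠ 0`, `Δȳ = Δy/‖Δy‖ + E^Q` and
`‖E^Q‖ ≤ (0.005/1.995)·(1/√κ(AS⁻²Aᵀ))`, then the angle `ψ` between `S⁻¹AᵀΔy` and
`S⁻¹AᵀΔȳ` satisfies `cos ψ ≥ 0.995` and `sin ψ ≤ 0.1`. -/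
theorem stmt6 {m n : ℕ} (A : Matrix (Fin m) (Fin n) ℝ) (b : Fin m → ℝ)
    (hrank : A.rank = m) (hmn : m ≤ n)
    (s : Fin n → ℝ) (hs : ∀ i, 0 < s i)
    (μ : ℝ) (hμ : 0 < μ)
    (rp : Fin m → ℝ) (hrp : rp = b - μ • A.mulVec s⁻¹)
    (hPD : (A * Matrix.diagonal (fun i => ((s i) ^ 2)⁻¹) * A.transpose).PosDef)
    (Δy : Fin m → ℝ)
    (hΔy : Δy = (1 / μ) •
      ((A * Matrix.diagonal (fun i => ((s i) ^ 2)⁻¹) * A.transpose)⁻¹).mulVec rp)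
    (hΔy0 : Δy ≠ 0)
    (EQ : Fin m → ℝ) (Δybar : Fin m → ℝ)
    (hΔybar : Δybar = (1 / norm2 Δy) • Δy + EQ)
    (hEQ : norm2 EQ ≤ (0.005 / 1.995) *
      (1 / Real.sqrt ((⨆ i, hPD.1.eigenvalues i) / (⨅ i, hPD.1.eigenvalues i))))
    (w₁ w₂ : Fin n → ℝ)
    (hw₁ : w₁ = s⁻¹ * A.transpose.mulVec Δy)
    (hw₂ : w₂ = s⁻¹ * A.transpose.mulVec Δybar)
    (cosψ : ℝ) (hcos : cosψ = (w₁ ⬝ᵥ w₂) / (norm2 w₁ * norm2 w₂))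
    (sinψ : ℝ) (hsin : sinψ = Real.sqrt (1 - cosψ ^ 2)) :
    0.995 ≤ cosψ ∧ sinψ ≤ 0.1 := by
  have : Nonempty (Fin m) := by
    by_contra h
    rw [not_nonempty_iff] at h
    exact hΔy0 (Subsingleton.elim _ _)
  have hquad := norm2_scaled_transpose_mulVec_sq A s
  have hlow := iInf_eigenvalues_mul_le_dotProduct_mulVec hPD.1 Δy
  have hup := dotProduct_mulVec_le_iSup_eigenvalues_mul hPD.1 EQ
  rw [← hquad] at hlow hup
  have hl : 0 < ⨅ i, hPD.1.eigenvalues i := by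
    obtain ⟨i, hi⟩ := exists_eq_ciInf_of_finite (f := hPD.1.eigenvalues)
    exact hi ▸ hPD.eigenvalues_pos i
  have hL : 0 < ⨆ i, hPD.1.eigenvalues i := by
    obtain ⟨i, hi⟩ := exists_eq_ciSup_of_finite (f := hPD.1.eigenvalues)
    exact hi ▸ hPD.eigenvalues_pos i
  set l := ⨅ i, hPD.1.eigenvalues i
  set L := ⨆ i, hPD.1.eigenvalues i
  rw [← hw₁] at hlow
  have hN : 0 < norm2 Δy := norm2_pos hΔy0
  have hw₁_pos : 0 < norm2 w₁ := by
    have h : 0 < norm2 w₁ ^ 2 := (by positivity : 0 < l * norm2 Δy ^ 2).trans_le hlow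
    exact (norm2_nonneg w₁).lt_of_ne' (pow_ne_zero_iff two_ne_zero |>.1 h.ne')
  have hEQ_sq : norm2 EQ ^ 2 ≤ (0.005 / 1.995) ^ 2 * (l / L) := by
    refine (pow_le_pow_left₀ (norm2_nonneg _) hEQ 2).trans_eq ?_
    rw [mul_pow, div_pow 1, Real.sq_sqrt (by positivity), one_pow, one_div_div]
  have herr : norm2 (s⁻¹ * Aᵀ *ᵥ EQ) ≤ 0.005 / 1.995 * (1 / norm2 Δy * norm2 w₁) := by
    refine (sq_le_sq₀ (norm2_nonneg _) (by positivity)).1 ?_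
    calc norm2 (s⁻¹ * Aᵀ *ᵥ EQ) ^ 2 ≤ L * norm2 EQ ^ 2 := hup
      _ ≤ L * ((0.005 / 1.995) ^ 2 * (l / L)) := mul_le_mul_of_nonneg_left hEQ_sq hL.le
      _ = (0.005 / 1.995) ^ 2 * (1 / norm2 Δy) ^ 2 * (l * norm2 Δy ^ 2) := by field_simp
      _ ≤ (0.005 / 1.995) ^ 2 * (1 / norm2 Δy) ^ 2 * norm2 w₁ ^ 2 :=
        mul_le_mul_of_nonneg_left hlow (by positivity)
      _ = _ := by ring
  have hw₂' : w₂ = (1 / norm2 Δy) • w₁ + s⁻¹ * Aᵀ *ᵥ EQ := by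
    rw [hw₂, hΔybar, mulVec_add, mulVec_smul, mul_add, mul_smul_comm, hw₁]
  have hcos_ge : 0.995 ≤ cosψ := by
    have h := le_cos_angle_of_relative_perturbation (one_div_pos.2 hN) (by norm_num)
      (by norm_num) hw₁_pos herr
    rw [← hw₂', ← hcos] at h
    norm_num at h ⊢
    exact h
  refine ⟨hcos_ge, ?_⟩
  rw [hsin]
  refine Real.sqrt_le_iff.2 ⟨by norm_num, ?_⟩
  norm_num at hcos_ge ⊢
  nlinarith
end

section
/- Let 0 < ζ̂ < 1, let k ≥ 1, and let (y, s) be strictly dual feasible for the dual LP (Aᵀy + s = c, s > 0). Set ∇ = ζ̂^{-k} and suppose (ŷ, ŝ) satisfies Aᵀŷ + ŝ = ∇s with ŝ > 0, and that the refining proximity δ_IR(ŝ, ζ̂) = (1/ζ̂)·min{‖ζ̂e − ŝ∘x̂‖₂ : Ax̂ = ∇b} ≤ 0.5. Define y⁺ = y + ζ̂^k·ŷ and s⁺ = c − Aᵀy⁺. Then s⁺ = ζ̂^k·ŝ > 0, so (y⁺, s⁺) is strictly dual feasible, and δ(s⁺, ζ̂^{2k+1}) = δ_IR(ŝ, ζ̂)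 ≤ 0.5, where δ(s,μ) = (1/μ)·min{‖μe − s∘x‖₂ : Ax = b}. -/
open Matrix

lemma norm2_smul {k : ℕ} {a : ℝ} (ha : 0 ≤ a) (v : Fin k → ℝ) : norm2 (a • v) = a * norm2 v := by
  simp only [norm2, Pi.smul_apply, smul_eq_mul, mul_pow, ← Finset.mul_sum]
  rw [Real.sqrt_mul (sq_nonneg a), Real.sqrt_sq ha]

open scoped Pointwise in
/-- Scaling the slack and the primal vector by `r` scales the set of attainable residual norms
by `r ^ 2`. -/
lemma residual_norms_smul {m n : ℕ} (A : Matrix (Fin m) (Fin n) ℝ) (b : Fin m → ℝ)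
    (s : Fin n → ℝ) (μ : ℝ) {r : ℝ} (hr : 0 < r) :
    {t : ℝ | ∃ x : Fin n → ℝ, A.mulVec x = b ∧
        t = norm2 ((r ^ 2 * μ) • (1 : Fin n → ℝ) - (r • s) * x)} =
      r ^ 2 • {t : ℝ | ∃ x : Fin n → ℝ, A.mulVec x = r⁻¹ • b ∧
        t = norm2 (μ • (1 : Fin n → ℝ) - s * x)} := by
  have key (x : Fin n → ℝ) : norm2 ((r ^ 2 * μ) • (1 : Fin n → ℝ) - (r • s) * (r • x)) =
      r ^ 2 * norm2 (μ • (1 : Fin n → ℝ) - s * x) := by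
    rw [← norm2_smul (sq_nonneg r)]
    congr 1
    ext i
    simp
    ring
  ext t
  simp only [Set.mem_smul_set, Set.mem_ofPred_eq]
  constructor
  · rintro ⟨x, hx, rfl⟩
    refine ⟨_, ⟨r⁻¹ • x, by rw [Matrix.mulVec_smul, hx], rfl⟩, ?_⟩
    rw [smul_eq_mul, ← key, smul_inv_smul₀ hr.ne']
  · rintro ⟨_, ⟨x, hx, rfl⟩, rfl⟩
    exact ⟨r • x, by rw [Matrix.mulVec_smul, hx, smul_inv_smul₀ hr.ne'],
      by rw [smul_eq_mul, key]⟩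

/-- With `0 < ζ̂ < 1`, `k ≥ 1`, `(y,s)` strictly dual feasible,
`∇ = ζ̂^{-k}`, and `(ŷ,ŝ)` strictly feasible for the refining problem with
`δ_IR(ŝ,ζ̂) ≤ 0.5`, the update `y⁺ = y + ζ̂^k ŷ`, `s⁺ = c − Aᵀy⁺` satisfies
`s⁺ = ζ̂^k ŝ > 0` (strict dual feasibility) and `δ(s⁺, ζ̂^{2k+1}) = δ_IR(ŝ,ζ̂) ≤ 0.5`. -/
theorem stmt13 {m n : ℕ} (A : Matrix (Fin m) (Fin n) ℝ) (b : Fin m → ℝ) (c : Fin n → ℝ)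
    (hrank : A.rank = m) (hmn : m ≤ n)
    (zh : ℝ) (hzh0 : 0 < zh) (hzh1 : zh < 1)
    (k : ℕ) (hk : 1 ≤ k)
    (y : Fin m → ℝ) (s : Fin n → ℝ)
    (hdf : A.transpose.mulVec y + s = c) (hs : ∀ i, 0 < s i)
    (nab : ℝ) (hnab : nab = (zh ^ k)⁻¹)
    (yh : Fin m → ℝ) (sh : Fin n → ℝ)
    (hrf : A.transpose.mulVec yh + sh = nab • s) (hsh : ∀ i, 0 < sh i)
    (hfeas : ∃ xh : Fin n → ℝ, A.mulVec xh = nab • b ∧ ∀ i, 0 ≤ xh i)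
    (hδIR : (1 / zh) * sInf {t : ℝ | ∃ xh : Fin n → ℝ, A.mulVec xh = nab • b ∧
        t = norm2 (zh • (1 : Fin n → ℝ) - sh * xh)} ≤ 0.5)
    (yp : Fin m → ℝ) (hyp : yp = y + zh ^ k • yh)
    (sp : Fin n → ℝ) (hsp : sp = c - A.transpose.mulVec yp) :
    sp = zh ^ k • sh ∧
    (∀ i, 0 < sp i) ∧
    A.transpose.mulVec yp + sp = c ∧
    (1 / zh ^ (2 * k + 1)) * sInf {t : ℝ | ∃ x : Fin n → ℝ, A.mulVec x = b ∧
        t = norm2 (zh ^ (2 * k + 1) • (1 : Fin n → ℝ) - sp * x)} =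
      (1 / zh) * sInf {t : ℝ | ∃ xh : Fin n → ℝ, A.mulVec xh = nab • b ∧
        t = norm2 (zh • (1 : Fin n → ℝ) - sh * xh)} ∧
    (1 / zh ^ (2 * k + 1)) * sInf {t : ℝ | ∃ x : Fin n → ℝ, A.mulVec x = b ∧
        t = norm2 (zh ^ (2 * k + 1) • (1 : Fin n → ℝ) - sp * x)} ≤ 0.5 := by
  have hr : 0 < zh ^ k := pow_pos hzh0 k
  have hspsh : sp = zh ^ k • sh := by
    have hsh_eq : sh = (zh ^ k)⁻¹ • s - A.transpose.mulVec yh := by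
      rw [← hnab, ← hrf, add_sub_cancel_left]
    rw [hsp, hyp, ← hdf, hsh_eq, Matrix.mulVec_add, Matrix.mulVec_smul, smul_sub,
      smul_inv_smul₀ hr.ne']
    abel
  have hδ : (1 / zh ^ (2 * k + 1)) * sInf {t : ℝ | ∃ x : Fin n → ℝ, A.mulVec x = b ∧
        t = norm2 (zh ^ (2 * k + 1) • (1 : Fin n → ℝ) - sp * x)} =
      (1 / zh) * sInf {t : ℝ | ∃ xh : Fin n → ℝ, A.mulVec xh = nab • b ∧
        t = norm2 (zh • (1 : Fin n → ℝ) - sh * xh)} := by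
    have hpow : zh ^ (2 * k + 1) = (zh ^ k) ^ 2 * zh := by ring
    rw [hspsh, hnab, hpow, residual_norms_smul A b sh zh hr,
      Real.sInf_smul_of_nonneg (sq_nonneg _), smul_eq_mul]
    field_simp
  refine ⟨hspsh, fun i => ?_, by rw [hsp, add_sub_cancel], hδ, hδ.trans_le hδIR⟩
  rw [hspsh]
  exact mul_pos hr (hsh i)
end
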